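/- Let 0 = t_{-1} < t_0 < t_1 < … < t_N be real numbers, let I_k := (t_{k-1}, t_k) for k = 0,…,N, let λ_k := 0 if k is even and λ_k := π if k is odd, and let Ĩ_k := r(I_k − λ_k) ⊆ ℝ/(2πℤ). Then the following are equivalent: (1) there exists a constant c > 0 such that for all finitely supported sequences a, b : ℕ → ℝ (with a_0 = b_0 = 0) one has Σ_{k=0}^{N} ∫_{t_{k-1}}^{t_k} (f_{a,b}(t − λ_k))² dt ≥ c · E(a,b); (2) μ( (⋃_{k=0}^{N} Ĩ_k)ᶜ ) = 0. -/

import Mathlib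

open MeasureTheory Set Real Filter Topology

noncomputable section

instance : Fact (0 < 2 * Real.pi) := ⟨by positivity⟩

/-- λ_k: 0 for even k, π for odd k. -/
def lam (k : ℕ) : ℝ := if Even k then 0 else Real.pi

/-- The boundary trace f_{a,b}(t) = Σ_{j≥1} (j·a_j·cos(jt) + b_j·sin(jt)), i.e.
∂_x u(0,t) for the solution of the wave equation with Fourier data (a,b). -/
def bTrace (a b : ℕ →₀ ℝ) (t : ℝ) : ℝ :=
  ∑ j ∈ a.support ∪ b.support,
    ((j : ℝ) * a j * Real.cos ((j : ℝ) * t) + b j * Real.sin ((j : ℝ) * t))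

/-- The energy E(a,b) = Σ_{j≥1} (j²·a_j² + b_j²). -/
def energy (a b : ℕ →₀ ℝ) : ℝ :=
  ∑ j ∈ a.support ∪ b.support, ((j : ℝ) ^ 2 * (a j) ^ 2 + (b j) ^ 2)


lemma bTrace_eq_sum (a b : ℕ →₀ ℝ) (S : Finset ℕ) (hS : a.support ∪ b.support ⊆ S) (t : ℝ) :
    bTrace a b t = ∑ j ∈ S,
      ((j : ℝ) * a j * Real.cos ((j : ℝ) * t) + b j * Real.sin ((j : ℝ) * t)) := by
  unfold bTrace
  apply Finset.sum_subset hS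
  intro j _ hj
  simp only [Finset.mem_union, Finsupp.mem_support_iff, not_or, not_not] at hj
  simp [hj.1, hj.2]

lemma bTrace_add (a b a' b' : ℕ →₀ ℝ) (t : ℝ) :
    bTrace (a + a') (b + b') t = bTrace a b t + bTrace a' b' t := by
  classical
  set S := ((a.support ∪ b.support) ∪ (a'.support ∪ b'.support)) ∪
    ((a + a').support ∪ (b + b').support) with hS
  rw [bTrace_eq_sum a b S, bTrace_eq_sum a' b' S, bTrace_eq_sum (a + a') (b + b') S,
    ← Finset.sum_add_distrib]
  · apply Finset.sum_congr rfl
    intro j _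
    simp only [Finsupp.add_apply]
    ring
  · exact Finset.subset_union_right
  · exact (Finset.subset_union_right).trans Finset.subset_union_left
  · exact (Finset.subset_union_left).trans Finset.subset_union_left

lemma bTrace_cont (a b : ℕ →₀ ℝ) : Continuous (bTrace a b) := by
  unfold bTrace
  fun_prop

lemma int_cos_nat (n : ℤ) (hn : n ≠ 0) : ∫ t in (0:ℝ)..(2 * π), Real.cos ((n : ℝ) * t) = 0 := by
  have h : (n : ℝ) ≠ 0 := by exact_mod_cast hn
  rw [intervalIntegral.integral_comp_mul_left (fun x => Real.cos x) h, integral_cos]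
  have : Real.sin ((n : ℝ) * (2 * π)) = 0 := by
    have := Real.sin_int_mul_pi (2 * n)
    push_cast at this
    rw [← this]; ring_nf
  simp [this]

lemma int_sin_nat (n : ℤ) : ∫ t in (0:ℝ)..(2 * π), Real.sin ((n : ℝ) * t) = 0 := by
  by_cases hn : n = 0
  · simp [hn]
  have h : (n : ℝ) ≠ 0 := by exact_mod_cast hn
  rw [intervalIntegral.integral_comp_mul_left (fun x => Real.sin x) h, integral_sin]
  simp [Real.cos_int_mul_two_pi]

lemma bTrace_int (a b : ℕ →₀ ℝ) (ha : a 0 = 0) (hb : b 0 = 0) :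
    ∫ t in (0:ℝ)..(2 * π), bTrace a b t = 0 := by
  unfold bTrace
  rw [intervalIntegral.integral_finsetSum]
  · apply Finset.sum_eq_zero
    intro j _
    rw [intervalIntegral.integral_add (Continuous.intervalIntegrable (by fun_prop) _ _)
      (Continuous.intervalIntegrable (by fun_prop) _ _), intervalIntegral.integral_const_mul,
      intervalIntegral.integral_const_mul]
    by_cases hj : j = 0
    · simp [hj, ha, hb]
    have h1 := int_cos_nat (j : ℤ) (by exact_mod_cast hj)
    have h2 := int_sin_nat (j : ℤ)
    push_cast at h1 h2
    simp [h1, h2]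
  · intro j _
    exact Continuous.intervalIntegrable (by fun_prop) _ _

lemma int_prod (i j : ℕ) (hi : i ≠ 0) (A B C D : ℝ) :
    ∫ t in (0:ℝ)..(2 * π), (A * Real.cos ((i : ℝ) * t) + B * Real.sin ((i : ℝ) * t)) *
      (C * Real.cos ((j : ℝ) * t) + D * Real.sin ((j : ℝ) * t)) =
      if i = j then π * (A * C + B * D) else 0 := by
  have key : ∀ t : ℝ, (A * Real.cos ((i : ℝ) * t) + B * Real.sin ((i : ℝ) * t)) *
      (C * Real.cos ((j : ℝ) * t) + D * Real.sin ((j : ℝ) * t)) =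
      ((A * C + B * D) / 2) * Real.cos ((((i : ℤ) - (j : ℤ) : ℤ) : ℝ) * t) +
      ((A * C - B * D) / 2) * Real.cos ((((i : ℤ) + (j : ℤ) : ℤ) : ℝ) * t) +
      ((A * D + B * C) / 2) * Real.sin ((((i : ℤ) + (j : ℤ) : ℤ) : ℝ) * t) +
      ((B * C - A * D) / 2) * Real.sin ((((i : ℤ) - (j : ℤ) : ℤ) : ℝ) * t) := by
    intro t
    push_cast
    rw [sub_mul, add_mul (i : ℝ) (j : ℝ) t, Real.cos_sub, Real.cos_add, Real.sin_add, Real.sin_sub]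
    ring
  simp_rw [key]
  rw [intervalIntegral.integral_add (Continuous.intervalIntegrable (by fun_prop) _ _)
      (Continuous.intervalIntegrable (by fun_prop) _ _),
    intervalIntegral.integral_add (Continuous.intervalIntegrable (by fun_prop) _ _)
      (Continuous.intervalIntegrable (by fun_prop) _ _),
    intervalIntegral.integral_add (Continuous.intervalIntegrable (by fun_prop) _ _)
      (Continuous.intervalIntegrable (by fun_prop) _ _)]
  simp_rw [intervalIntegral.integral_const_mul]
  rw [int_sin_nat, int_sin_nat, int_cos_nat ((i : ℤ) + (j : ℤ)) (by omega)]
  split_ifs with h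
  · subst h
    simp
    ring
  · rw [int_cos_nat ((i : ℤ) - (j : ℤ)) (by omega)]
    simp

lemma bTrace_sq_int (a b : ℕ →₀ ℝ) (ha : a 0 = 0) (hb : b 0 = 0) :
    ∫ t in (0:ℝ)..(2 * π), (bTrace a b t) ^ 2 = π * energy a b := by
  unfold bTrace energy
  simp_rw [sq (Finset.sum _ _), Finset.sum_mul_sum]
  rw [intervalIntegral.integral_finsetSum
    (fun i _ => Continuous.intervalIntegrable (by fun_prop) _ _), Finset.mul_sum]
  apply Finset.sum_congr rfl
  intro i hi
  have hi0 : i ≠ 0 := by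
    rintro rfl
    simp [ha, hb] at hi
  rw [intervalIntegral.integral_finsetSum
    (fun i _ => Continuous.intervalIntegrable (by fun_prop) _ _)]
  simp_rw [int_prod i _ hi0]
  rw [Finset.sum_ite_eq, if_pos hi]
  ring

lemma bTrace_periodic (a b : ℕ →₀ ℝ) (z : ℤ) (t : ℝ) :
    bTrace a b (t + z * (2 * π)) = bTrace a b t := by
  unfold bTrace
  apply Finset.sum_congr rfl
  intro j _
  have : (j : ℝ) * (t + z * (2 * π)) = j * t + ((j * z : ℤ) : ℝ) * (2 * π) := by
    push_cast; ring
  rw [this, Real.cos_add_int_mul_two_pi, Real.sin_add_int_mul_two_pi]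

lemma cover_lintegral (N : ℕ) (t : ℕ → ℝ) (F : ℝ → ENNReal) (hF : Measurable F)
    (hper : ∀ (z : ℤ) x, F (x + z * (2 * π)) = F x)
    (h : volume ((⋃ k ∈ Finset.range (N + 1),
          (fun x : ℝ => ((x - lam k : ℝ) : AddCircle (2 * Real.pi))) ''
            Set.Ioo (t k) (t (k + 1)))ᶜ) = 0) :
    ∫⁻ x in Ioc 0 (2 * π), F x ≤
      ∑ k ∈ Finset.range (N + 1), ∫⁻ s in Ioo (t k) (t (k + 1)), F (s - lam k) := by
  set U := (⋃ k ∈ Finset.range (N + 1),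
          (fun x : ℝ => ((x - lam k : ℝ) : AddCircle (2 * Real.pi))) ''
            Set.Ioo (t k) (t (k + 1))) with hU
  have hae : ∀ᵐ x ∂(volume.restrict (Ioc 0 (0 + 2 * π))), ((x : ℝ) : AddCircle (2 * π)) ∈ U :=
    (AddCircle.measurePreserving_mk (2 * π) 0).quasiMeasurePreserving.ae
      (p := fun y => y ∈ U) h
  rw [zero_add] at hae
  let G : ℕ → ℝ → ENNReal := fun k x => (Ioo (t k) (t (k + 1))).indicator (fun s => F (s - lam k))
    (x + lam k)
  have hG : ∀ k, Measurable (G k) := by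
    intro k
    have : Measurable ((Ioo (t k) (t (k + 1))).indicator (fun s => F (s - lam k))) :=
      (hF.comp (measurable_id.sub_const _)).indicator measurableSet_Ioo
    exact this.comp (measurable_id.add_const _)
  have h1 : ∫⁻ x in Ioc 0 (2 * π), F x ≤ ∫⁻ x in Ioc 0 (2 * π),
      ∑ k ∈ Finset.range (N + 1), ∑' g : AddSubgroup.zmultiples (2 * π), G k (g +ᵥ x) := by
    apply lintegral_mono_ae
    filter_upwards [hae] with x hx
    simp only [hU, mem_iUnion, mem_image] at hx
    obtain ⟨k, hk, y, hy, hyx⟩ := hx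
    have h2 := AddCircle.coe_eq_zero_iff (2 * π) (x := y - lam k - x) |>.1 (by
      rw [AddCircle.coe_sub, hyx, sub_self])
    obtain ⟨n, hn⟩ := h2
    have hy' : y = n * (2 * π) + x + lam k := by
      rw [zsmul_eq_mul] at hn; linarith
    refine le_trans ?_ (Finset.single_le_sum (f := fun k =>
      ∑' g : AddSubgroup.zmultiples (2 * π), G k (g +ᵥ x)) (fun _ _ => zero_le) hk)
    refine le_trans ?_ (ENNReal.le_tsum (⟨n • (2 * π), n, rfl⟩ : AddSubgroup.zmultiples (2 * π)))
    simp only [G, AddSubgroup.vadd_def, vadd_eq_add, zsmul_eq_mul]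
    rw [← hy', indicator_of_mem hy, hy', add_sub_cancel_right, add_comm, hper]
  refine h1.trans (le_of_eq ?_)
  have hG' : ∀ (k : ℕ) (g : AddSubgroup.zmultiples (2 * π)), Measurable fun x : ℝ => G k (g +ᵥ x) :=
    fun k g => (hG k).comp (measurable_const_add (g : ℝ))
  have hc : Countable (AddSubgroup.zmultiples (2 * π)) := inferInstance
  rw [lintegral_finsetSum _ (fun k _ => Measurable.tsum (hG' k))]
  apply Finset.sum_congr rfl
  intro k _
  rw [lintegral_tsum (fun g => (hG' k g).aemeasurable)]
  have := (isAddFundamentalDomain_Ioc (T := 2 * π) (by positivity) 0).lintegral_eq_tsum'' (G k)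
  rw [zero_add] at this
  rw [← this]
  simp only [G]
  rw [lintegral_add_right_eq_self, lintegral_indicator measurableSet_Ioo]

lemma dir2 (N : ℕ) (t : ℕ → ℝ)
    (hmono : ∀ k, k ≤ N → t k < t (k + 1))
    (h : volume ((⋃ k ∈ Finset.range (N + 1),
          (fun x : ℝ => ((x - lam k : ℝ) : AddCircle (2 * Real.pi))) ''
            Set.Ioo (t k) (t (k + 1)))ᶜ) = 0) (a b : ℕ →₀ ℝ) (ha : a 0 = 0) (hb : b 0 = 0) :
    π * energy a b ≤ ∑ k ∈ Finset.range (N + 1),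
            ∫ s in (t k)..(t (k + 1)), (bTrace a b (s - lam k)) ^ 2 := by
  have hc := bTrace_cont a b
  have key := cover_lintegral N t (fun x => ENNReal.ofReal (bTrace a b x ^ 2))
    (by fun_prop) (fun z x => by rw [bTrace_periodic]) h
  have conv : ∀ (l p q : ℝ), p ≤ q → ∫⁻ x in Ioc p q, ENNReal.ofReal (bTrace a b (x - l) ^ 2) =
      ENNReal.ofReal (∫ s in p..q, bTrace a b (s - l) ^ 2) := by
    intro l p q hpq
    rw [intervalIntegral.integral_of_le hpq, ofReal_integral_eq_lintegral_ofReal]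
    · exact (Continuous.integrableOn_Ioc (by fun_prop))
    · exact Filter.Eventually.of_forall fun x => sq_nonneg _
  have e0 := conv 0 0 (2 * π) (by positivity)
  simp only [sub_zero] at e0
  rw [e0, bTrace_sq_int a b ha hb] at key
  have e1 : ∀ k ∈ Finset.range (N + 1), ∫⁻ s in Ioo (t k) (t (k + 1)),
      ENNReal.ofReal (bTrace a b (s - lam k) ^ 2) =
      ENNReal.ofReal (∫ s in (t k)..(t (k + 1)), (bTrace a b (s - lam k)) ^ 2) := by
    intro k hk
    rw [← conv _ _ _ (hmono k (by simp at hk; omega)).le, restrict_Ioo_eq_restrict_Ioc]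
  have e2 : ∀ k ∈ Finset.range (N + 1),
      0 ≤ ∫ s in (t k)..(t (k + 1)), (bTrace a b (s - lam k)) ^ 2 := by
    intro k hk
    exact intervalIntegral.integral_nonneg (hmono k (by simp at hk; omega)).le
      fun _ _ => sq_nonneg _
  rw [Finset.sum_congr rfl e1, ← ENNReal.ofReal_sum_of_nonneg e2,
    ENNReal.ofReal_le_ofReal_iff (Finset.sum_nonneg e2)] at key
  exact key

lemma fourier_re (n : ℤ) (z : ℂ) (s : ℝ) :
    (z * fourier n (s : AddCircle (2 * π))).re =
      z.re * Real.cos (n * s) - z.im * Real.sin (n * s) := by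
  have h : (2 * π * Complex.I * n * s / ((2 * π : ℝ) : ℂ) : ℂ) = ((n * s : ℝ) : ℂ) * Complex.I := by
    have : (π : ℂ) ≠ 0 := by exact_mod_cast Real.pi_ne_zero
    push_cast
    field_simp
  rw [fourier_coe_apply, h, Complex.mul_re, Complex.exp_ofReal_mul_I_re,
    Complex.exp_ofReal_mul_I_im]

lemma bTrace_single (j : ℕ) (hj : j ≠ 0) (A B s : ℝ) :
    bTrace (Finsupp.single j (A / j)) (Finsupp.single j B) s =
      A * Real.cos (j * s) + B * Real.sin (j * s) := by
  have h : (j : ℝ) ≠ 0 := by exact_mod_cast hj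
  rw [bTrace_eq_sum _ _ {j} (Finset.union_subset Finsupp.support_single_subset
    Finsupp.support_single_subset)]
  simp only [Finset.sum_singleton, Finsupp.single_eq_same]
  rw [mul_div_cancel₀ _ h]

lemma span_re (p : C(AddCircle (2 * π), ℂ))
    (hp : p ∈ Submodule.span ℂ (range (@fourier (2 * π)))) :
    ∀ z : ℂ, ∃ (a b : ℕ →₀ ℝ) (c : ℝ), a 0 = 0 ∧ b 0 = 0 ∧
      ∀ s : ℝ, (z * p (s : AddCircle (2 * π))).re = c + bTrace a b s := by
  induction hp using Submodule.span_induction with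
  | mem x hx =>
    obtain ⟨n, rfl⟩ := hx
    intro z
    by_cases hn : n = 0
    · refine ⟨0, 0, z.re, rfl, rfl, fun s => ?_⟩
      rw [fourier_re]
      simp [hn, bTrace]
    have hj : n.natAbs ≠ 0 := by simpa using hn
    rcases Int.natAbs_eq n with h | h
    · refine ⟨Finsupp.single n.natAbs (z.re / n.natAbs), Finsupp.single n.natAbs (-z.im), 0,
        by simp [hn], by simp [hn], fun s => ?_⟩
      rw [fourier_re, bTrace_single _ hj]
      have : (n : ℝ) = (n.natAbs : ℝ) := by
        conv_lhs => rw [h]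
        simp
      rw [this]; ring
    · refine ⟨Finsupp.single n.natAbs (z.re / n.natAbs), Finsupp.single n.natAbs (z.im), 0,
        by simp [hn], by simp [hn], fun s => ?_⟩
      rw [fourier_re, bTrace_single _ hj]
      have : (n : ℝ) = -(n.natAbs : ℝ) := by
        conv_lhs => rw [h]
        simp
      rw [this, neg_mul, Real.cos_neg, Real.sin_neg]; ring
  | zero =>
    intro z
    exact ⟨0, 0, 0, rfl, rfl, fun s => by simp [bTrace]⟩
  | add x y _ _ hx hy =>
    intro z
    obtain ⟨a, b, c, ha, hb, h⟩ := hx z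
    obtain ⟨a', b', c', ha', hb', h'⟩ := hy z
    refine ⟨a + a', b + b', c + c', by simp [ha, ha'], by simp [hb, hb'], fun s => ?_⟩
    rw [bTrace_add, ContinuousMap.add_apply, mul_add, Complex.add_re, h, h']
    ring
  | smul w x _ hx =>
    intro z
    obtain ⟨a, b, c, ha, hb, h⟩ := hx (z * w)
    refine ⟨a, b, c, ha, hb, fun s => ?_⟩
    rw [← h, ContinuousMap.smul_apply, smul_eq_mul, mul_assoc]

lemma approx (g : C(AddCircle (2 * π), ℝ)) (ε : ℝ) (hε : 0 < ε) :
    ∃ (a b : ℕ →₀ ℝ) (c : ℝ), a 0 = 0 ∧ b 0 = 0 ∧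
      ∀ s : ℝ, |c + bTrace a b s - g (s : AddCircle (2 * π))| ≤ ε := by
  let gc : C(AddCircle (2 * π), ℂ) := ⟨fun x => (g x : ℂ), by fun_prop⟩
  have hm : gc ∈ (Submodule.span ℂ (range (@fourier (2 * π)))).topologicalClosure := by
    rw [span_fourier_closure_eq_top]; trivial
  rw [← SetLike.mem_coe, Submodule.topologicalClosure_coe, Metric.mem_closure_iff] at hm
  obtain ⟨p, hp, hd⟩ := hm ε hε
  obtain ⟨a, b, c, ha, hb, h⟩ := span_re p hp 1
  refine ⟨a, b, c, ha, hb, fun s => ?_⟩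
  rw [← h, one_mul]
  have h1 := ContinuousMap.dist_apply_le_dist (f := gc) (g := p) (s : AddCircle (2 * π))
  rw [dist_comm, Complex.dist_eq] at h1
  have h2 := Complex.abs_re_le_norm (p (s : AddCircle (2 * π)) - gc (s : AddCircle (2 * π)))
  have h3 : (p (s : AddCircle (2 * π)) - gc (s : AddCircle (2 * π))).re =
    (p (s : AddCircle (2 * π))).re - g (s : AddCircle (2 * π)) := by simp [gc]
  rw [h3] at h2
  linarith

lemma int_pos_circle (φ : AddCircle (2 * π) → ℝ) (hφ : Continuous φ) (h0 : ∀ x, 0 ≤ φ x)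
    (x0 : AddCircle (2 * π)) (hx : 0 < φ x0) : 0 < ∫ s in (0:ℝ)..(2 * π), φ (s : AddCircle (2 * π)) := by
  obtain ⟨y, hy, rfl⟩ : x0 ∈ ((↑) : ℝ → AddCircle (2 * π)) '' Ico 0 (0 + 2 * π) := by
    rw [AddCircle.coe_image_Ico_eq]; trivial
  rw [zero_add] at hy
  refine intervalIntegral.integral_pos (by positivity)
    (hφ.comp (AddCircle.continuous_mk' _)).continuousOn (fun x _ => h0 _) ⟨y, Ico_subset_Icc_self hy, hx⟩

lemma exists_g (V : Set (AddCircle (2 * π))) (hV : IsClosed V) (hne : V.Nonempty)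
    (hc : Vᶜ.Nonempty) : ∃ g : C(AddCircle (2 * π), ℝ), (∀ x ∈ V, g x = 0) ∧
      (∫ s in (0:ℝ)..(2 * π), g (s : AddCircle (2 * π))) = 0 ∧
      0 < ∫ s in (0:ℝ)..(2 * π), g (s : AddCircle (2 * π)) ^ 2 := by
  let φ : AddCircle (2 * π) → ℝ := fun x => Metric.infDist x V
  have hφ : Continuous φ := Metric.continuous_infDist_pt V
  have hφ0 : ∀ x, 0 ≤ φ x := fun x => Metric.infDist_nonneg
  have hφV : ∀ x ∈ V, φ x = 0 := fun x hx => Metric.infDist_zero_of_mem hx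
  obtain ⟨x0, hx0⟩ := hc
  obtain ⟨v, hv⟩ := hne
  have hpos : 0 < φ x0 := (hV.notMem_iff_infDist_pos ⟨v, hv⟩).1 hx0
  have hI := int_pos_circle φ hφ hφ0 x0 hpos
  have hco : Continuous fun s : ℝ => φ (s : AddCircle (2 * π)) :=
    hφ.comp (AddCircle.continuous_mk' _)
  set I := ∫ s in (0:ℝ)..(2 * π), φ (s : AddCircle (2 * π)) with hIdef
  set J := ∫ s in (0:ℝ)..(2 * π), φ (s : AddCircle (2 * π)) ^ 2 with hJdef
  let g : C(AddCircle (2 * π), ℝ) := ⟨fun x => φ x ^ 2 - (J / I) * φ x, by fun_prop⟩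
  have hg : ∀ x, g x = φ x ^ 2 - (J / I) * φ x := fun x => rfl
  refine ⟨g, fun x hx => by rw [hg, hφV x hx]; ring, ?_, ?_⟩
  · simp_rw [hg]
    rw [intervalIntegral.integral_sub (Continuous.intervalIntegrable (by fun_prop) _ _)
      (Continuous.intervalIntegrable (by fun_prop) _ _), intervalIntegral.integral_const_mul,
      ← hIdef, ← hJdef]
    field_simp
    ring
  · obtain ⟨x1, hx1⟩ : ∃ x1, g x1 ≠ 0 := by
      by_contra hcon
      push Not at hcon
      have hx : ∃ y, φ y = φ x0 / 2 := by
        have := intermediate_value_univ v x0 hφ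
        exact this ⟨by rw [hφV v hv]; positivity, by linarith⟩
      obtain ⟨y, hy⟩ := hx
      have e1 := hcon x0
      have e2 := hcon y
      rw [hg] at e1 e2
      rw [hy] at e2
      have : φ x0 ^ 2 = 0 := by linarith
      exact hpos.ne' (by simpa using this)
    exact int_pos_circle (fun x => g x ^ 2) (by fun_prop) (fun x => sq_nonneg _) x1 (by positivity)

lemma exists_open (N : ℕ) (t : ℕ → ℝ)
    (h : volume ((⋃ k ∈ Finset.range (N + 1),
          (fun x : ℝ => ((x - lam k : ℝ) : AddCircle (2 * Real.pi))) ''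
            Set.Ioo (t k) (t (k + 1)))ᶜ) ≠ 0) :
    (⋃ k ∈ Finset.range (N + 1),
          (fun x : ℝ => ((x - lam k : ℝ) : AddCircle (2 * Real.pi))) ''
            Set.Icc (t k) (t (k + 1)))ᶜ.Nonempty := by
  by_contra hcon
  rw [not_nonempty_iff_eq_empty, compl_empty_iff] at hcon
  apply h
  let W : Set (AddCircle (2 * π)) := ⋃ k ∈ Finset.range (N + 1),
    (fun x : ℝ => ((x - lam k : ℝ) : AddCircle (2 * Real.pi))) '' {t k, t (k + 1)}
  have hW : W.Finite := by
    apply Set.Finite.biUnion (Finset.finite_toSet _)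
    intro k _
    exact (Set.toFinite _).image _
  refine measure_mono_null (t := W) ?_ ?_
  · intro x hx
    have hx' : x ∈ (⋃ k ∈ Finset.range (N + 1),
          (fun x : ℝ => ((x - lam k : ℝ) : AddCircle (2 * Real.pi))) ''
            Set.Icc (t k) (t (k + 1))) := by rw [hcon]; trivial
    simp only [mem_iUnion] at hx'
    obtain ⟨k, hk, y, hy, rfl⟩ := hx'
    simp only [W, mem_iUnion]
    refine ⟨k, hk, y, ?_, rfl⟩
    by_contra hy2
    apply hx
    simp only [mem_iUnion]
    simp only [mem_insert_iff, mem_singleton_iff, not_or] at hy2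
    exact ⟨k, hk, y, ⟨lt_of_le_of_ne hy.1 (Ne.symm hy2.1), lt_of_le_of_ne hy.2 hy2.2⟩, rfl⟩
  · rw [← biUnion_of_singleton W, measure_biUnion_null_iff hW.countable]
    intro x _
    have := AddCircle.volume_closedBall (2 * π) (x := x) 0
    simpa [Real.pi_pos.le] using this

lemma dir1 (N : ℕ) (t : ℕ → ℝ)
    (hmono : ∀ k, k ≤ N → t k < t (k + 1)) (c : ℝ) (hc : 0 < c)
    (hobs : ∀ a b : ℕ →₀ ℝ, a 0 = 0 → b 0 = 0 →
        c * energy a b ≤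
          ∑ k ∈ Finset.range (N + 1),
            ∫ s in (t k)..(t (k + 1)), (bTrace a b (s - lam k)) ^ 2) :
    volume ((⋃ k ∈ Finset.range (N + 1),
          (fun x : ℝ => ((x - lam k : ℝ) : AddCircle (2 * Real.pi))) ''
            Set.Ioo (t k) (t (k + 1)))ᶜ) = 0 := by
  by_contra hvol
  have hne := exists_open N t hvol
  set V := (⋃ k ∈ Finset.range (N + 1),
          (fun x : ℝ => ((x - lam k : ℝ) : AddCircle (2 * Real.pi))) ''
            Set.Icc (t k) (t (k + 1))) with hV
  have hmem : ∀ k ∈ Finset.range (N + 1), ∀ s ∈ Icc (t k) (t (k + 1)),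
      ((s - lam k : ℝ) : AddCircle (2 * π)) ∈ V := by
    intro k hk s hs
    simp only [hV, mem_iUnion]
    exact ⟨k, hk, s, hs, rfl⟩
  have hVc : IsClosed V := by
    refine (Finset.isCompact_biUnion _ fun k _ => ?_).isClosed
    refine isCompact_Icc.image ?_
    exact (AddCircle.continuous_mk' _).comp (by fun_prop)
  obtain ⟨g, hgV, hg0, hgJ⟩ := exists_g V hVc
    ⟨_, hmem 0 (by simp) (t 0) ⟨le_rfl, (hmono 0 (by omega)).le⟩⟩ hne
  set J := ∫ s in (0:ℝ)..(2 * π), g (s : AddCircle (2 * π)) ^ 2 with hJ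
  have hgc : Continuous fun s : ℝ => g (s : AddCircle (2 * π)) :=
    g.continuous.comp (AddCircle.continuous_mk' _)
  set L := ∑ k ∈ Finset.range (N + 1), (t (k + 1) - t k) with hL
  have hL0 : 0 ≤ L := Finset.sum_nonneg fun k hk =>
    sub_nonneg.2 (hmono k (by simp at hk; omega)).le
  have hpi := Real.pi_pos
  have main : ∀ ε : ℝ, 0 < ε → c * J ≤ (8 * π * L + 16 * π * c) * ε ^ 2 := by
    intro ε hε
    obtain ⟨a, b, d, ha, hb, hap⟩ := approx g ε hε
    have hfc := bTrace_cont a b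
    have hd : |d| ≤ ε := by
      have e1 : ∫ s in (0:ℝ)..(2 * π), (d + bTrace a b s - g (s : AddCircle (2 * π))) =
          2 * π * d := by
        rw [intervalIntegral.integral_sub (Continuous.intervalIntegrable (by fun_prop) _ _)
          (Continuous.intervalIntegrable (by fun_prop) _ _),
          intervalIntegral.integral_add (Continuous.intervalIntegrable (by fun_prop) _ _)
          (Continuous.intervalIntegrable (by fun_prop) _ _), hg0, bTrace_int a b ha hb]
        simp
      have e2 := intervalIntegral.norm_integral_le_of_norm_le_const (a := (0:ℝ)) (b := 2 * π)
        (C := ε) (f := fun s : ℝ => d + bTrace a b s - g (s : AddCircle (2 * π)))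
        (fun s _ => hap s)
      rw [e1, Real.norm_eq_abs, abs_mul, sub_zero, mul_comm ε] at e2
      have : |2 * π| = 2 * π := abs_of_pos (by positivity)
      rw [this] at e2
      exact le_of_mul_le_mul_left e2 (by positivity)
    have hfg : ∀ s : ℝ, |bTrace a b s - g (s : AddCircle (2 * π))| ≤ 2 * ε := by
      intro s
      have := hap s
      rw [abs_le] at *
      constructor <;> linarith
    have h1 : J ≤ 2 * (π * energy a b) + 16 * π * ε ^ 2 := by
      have : J ≤ ∫ s in (0:ℝ)..(2 * π), (2 * bTrace a b s ^ 2 + 8 * ε ^ 2) := by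
        apply intervalIntegral.integral_mono_on (by positivity)
          (Continuous.intervalIntegrable (by fun_prop) _ _)
          (Continuous.intervalIntegrable (by fun_prop) _ _)
        intro s _
        have h2 := sq_le_sq' (abs_le.1 (hfg s)).1 (abs_le.1 (hfg s)).2
        nlinarith [sq_nonneg (2 * bTrace a b s - g (s : AddCircle (2 * π)))]
      rw [intervalIntegral.integral_add (Continuous.intervalIntegrable (by fun_prop) _ _)
          (Continuous.intervalIntegrable (by fun_prop) _ _), intervalIntegral.integral_const_mul,
          bTrace_sq_int a b ha hb] at this
      simp at this
      linarith
    have h3 : ∑ k ∈ Finset.range (N + 1),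
            ∫ s in (t k)..(t (k + 1)), (bTrace a b (s - lam k)) ^ 2 ≤ L * (4 * ε ^ 2) := by
      rw [hL, Finset.sum_mul]
      apply Finset.sum_le_sum
      intro k hk
      have hle := (hmono k (by simp at hk; omega)).le
      have : ∫ s in (t k)..(t (k + 1)), (bTrace a b (s - lam k)) ^ 2 ≤
          ∫ s in (t k)..(t (k + 1)), 4 * ε ^ 2 := by
        apply intervalIntegral.integral_mono_on hle
          (Continuous.intervalIntegrable (by fun_prop) _ _)
          (Continuous.intervalIntegrable (by fun_prop) _ _)
        intro s hs
        have h2 := hfg (s - lam k)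
        rw [hgV _ (hmem k hk s hs), sub_zero] at h2
        have h4 := sq_le_sq' (abs_le.1 h2).1 (abs_le.1 h2).2
        linarith
      rw [intervalIntegral.integral_const, smul_eq_mul] at this
      exact this
    have h4 := (hobs a b ha hb).trans h3
    have h5 := mul_le_mul_of_nonneg_left h1 hc.le
    have h6 := mul_le_mul_of_nonneg_left h4 (by positivity : (0:ℝ) ≤ 2 * π)
    linarith
  set M := 8 * π * L + 16 * π * c with hM
  have hMpos : 0 < M := by positivity
  have := main (Real.sqrt (c * J / (2 * M))) (by positivity)
  rw [Real.sq_sqrt (by positivity)] at this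
  have e : M * (c * J / (2 * M)) = c * J / 2 := by field_simp
  rw [e] at this
  have : 0 < c * J := by positivity
  linarith

/-- Theorem 1.3: for 0 = t₋₁ < t₀ < … < t_N (here `t k` is the paper's t_{k-1}),
with I_k = (t_{k-1}, t_k) and Ĩ_k = r(I_k − λ_k) ⊆ ℝ/(2πℤ), the observability
inequality Σ_k ∫_{I_k} f_{a,b}(s − λ_k)² ds ≥ c·E(a,b) holds for some c > 0
uniformly in the data iff the sets Ĩ_0, …, Ĩ_N cover the circle up to a null set. -/
theorem stmt_0 (N : ℕ) (t : ℕ → ℝ) (ht0 : t 0 = 0)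
    (hmono : ∀ k, k ≤ N → t k < t (k + 1)) :
    (∃ c > 0, ∀ a b : ℕ →₀ ℝ, a 0 = 0 → b 0 = 0 →
        c * energy a b ≤
          ∑ k ∈ Finset.range (N + 1),
            ∫ s in (t k)..(t (k + 1)), (bTrace a b (s - lam k)) ^ 2) ↔
      volume ((⋃ k ∈ Finset.range (N + 1),
          (fun x : ℝ => ((x - lam k : ℝ) : AddCircle (2 * Real.pi))) ''
            Set.Ioo (t k) (t (k + 1)))ᶜ) = 0 := by
  constructor
  · rintro ⟨c, hc, hobs⟩
    exact dir1 N t hmono c hc hobs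
  · intro h
    exact ⟨π, Real.pi_pos, dir2 N t hmono h⟩
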